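/- The fundamental group of X₂ = W ∪ B (the Warsaw Circle with a second arc attached along the same two endpoints) is isomorphic to ℤ. -/

import Mathlib

open Real Set

/-- The graph part of the Sine Curve: `{(x, sin (π / x)) : 0 < x ≤ 1}`. -/
def sineGraph : Set (ℝ × ℝ) :=
  {p | ∃ x : ℝ, 0 < x ∧ x ≤ 1 ∧ p = (x, Real.sin (Real.pi / x))}

/-- The Sine Curve: the graph together with the vertical segment `{0} × [-1, 1]`. -/
def SineCurve : Set (ℝ × ℝ) :=
  sineGraph ∪ ({0} : Set ℝ) ×ˢ Icc (-1 : ℝ) 1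

/-- The arc `A = ({1} × [-2,0]) ∪ ([0,1] × {-2}) ∪ ({0} × [-2,-1])` joining `(1,0)` to
`(0,-1)` and meeting the Sine Curve only in these two endpoints. -/
def warsawArc : Set (ℝ × ℝ) :=
  ({1} : Set ℝ) ×ˢ Icc (-2 : ℝ) 0 ∪ Icc (0 : ℝ) 1 ×ˢ ({-2} : Set ℝ) ∪
    ({0} : Set ℝ) ×ˢ Icc (-2 : ℝ) (-1)

/-- The Warsaw Circle: the Sine Curve together with the arc `A`. -/
def WarsawCircle : Set (ℝ × ℝ) := SineCurve ∪ warsawArc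

/-- The second arc
`B = ([1,2] × {0}) ∪ ({2} × [-3,0]) ∪ ([-1,2] × {-3}) ∪ ({-1} × [-3,-1]) ∪ ([-1,0] × {-1})`
joining `(1,0)` to `(0,-1)` and meeting the Warsaw Circle only in these two endpoints. -/
def secondArc : Set (ℝ × ℝ) :=
  Icc (1 : ℝ) 2 ×ˢ ({0} : Set ℝ) ∪ ({2} : Set ℝ) ×ˢ Icc (-3 : ℝ) 0 ∪
    Icc (-1 : ℝ) 2 ×ˢ ({-3} : Set ℝ) ∪ ({-1} : Set ℝ) ×ˢ Icc (-3 : ℝ) (-1) ∪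
    Icc (-1 : ℝ) 0 ×ˢ ({-1} : Set ℝ)

/-- `X₂`: the Warsaw Circle together with a second arc attached along the same
two endpoints. -/
def Xtwo : Set (ℝ × ℝ) := WarsawCircle ∪ secondArc

open scoped unitInterval
open Topology

theorem locallyPathConnectedSpace_unitInterval : LocallyPathConnectedSpace I :=
  (IsQuotientMap.of_inverse continuous_subtype_val continuous_projIcc
    fun x ↦ projIcc_val (zero_le_one' ℝ) x).locallyPathConnectedSpace

theorem nonempty_fundamentalGroup_addCircle_mulEquiv {p : ℝ} (hp : p ≠ 0) :
    Nonempty (FundamentalGroup (AddCircle p) 0 ≃* Multiplicative ℤ) := by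
  let e := (AddCircle.isAddQuotientCoveringMap_coe p).fundamentalGroupEquiv
    (x := (0 : AddCircle p)) ⟨0, by simp⟩
  have hinj : Function.Injective (zmultiplesHom ℝ p) := fun m n h ↦ by
    simpa [hp] using h
  let f : ℤ ≃+ AddSubgroup.zmultiples p :=
    (AddMonoidHom.ofInjective hinj).trans
      (AddEquiv.addSubgroupCongr (AddSubgroup.range_zmultiplesHom p))
  let o : (Multiplicative (AddSubgroup.zmultiples p))ᵐᵒᵖ ≃*
      Multiplicative (AddSubgroup.zmultiples p) :=
    { MulOpposite.opEquiv.symm with map_mul' := fun a b ↦ mul_comm _ _ }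
  exact ⟨(e.trans o).trans (AddEquiv.toMultiplicative f).symm⟩

/-- A map `e` induces an isomorphism of fundamental groups as soon as it has a one-sided inverse
and a deformation onto its image that are continuous along all maps from locally connected
spaces. -/
theorem bijective_fundamentalGroup_map_of_slide {X Y : Type} [TopologicalSpace X]
    [TopologicalSpace Y] (e : C(Y, X)) (ρ : X → Y) (H : ℝ → X → X) (y₀ : Y)
    (hρ : ∀ {Z : Type} [TopologicalSpace Z] [LocallyConnectedSpace Z] (f : Z → X),
      Continuous f → Continuous (ρ ∘ f))
    (hH : ∀ {Z : Type} [TopologicalSpace Z] [LocallyConnectedSpace Z] (f : Z → X),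
      Continuous f → Continuous fun q : I × Z ↦ H q.1 (f q.2))
    (hρe : ∀ y, ρ (e y) = y) (hzero : ∀ x, H 0 x = x) (hone : ∀ x, H 1 x = e (ρ x))
    (hfix : ∀ s : I, H s (e y₀) = e y₀) :
    Function.Bijective (FundamentalGroup.map e y₀) := by
  have := locallyPathConnectedSpace_unitInterval
  constructor
  · intro a b hab
    obtain ⟨α, rfl⟩ := Path.Homotopic.Quotient.mk_surjective a
    obtain ⟨β, rfl⟩ := Path.Homotopic.Quotient.mk_surjective b
    obtain ⟨K⟩ : (α.map e.continuous).Homotopic (β.map e.continuous) :=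
      Path.Homotopic.Quotient.exact hab
    refine Path.Homotopic.Quotient.eq.2 ⟨⟨⟨⟨ρ ∘ K, hρ _ K.continuous⟩, ?_, ?_⟩, ?_⟩⟩
    · intro t
      simp [hρe]
    · intro t
      simp [hρe]
    · intro s t ht
      have := K.prop s t ht
      simpa [hρe] using congrArg ρ this
  · intro a
    obtain ⟨γ, rfl⟩ := Path.Homotopic.Quotient.mk_surjective a
    let α : Path y₀ y₀ := ⟨⟨ρ ∘ γ, hρ _ γ.continuous⟩, by simp [hρe], by simp [hρe]⟩
    refine ⟨Path.Homotopic.Quotient.mk α, ?_⟩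
    refine Path.Homotopic.Quotient.eq.2 (Path.Homotopic.symm ?_)
    refine ⟨⟨⟨⟨fun q ↦ H q.1 (γ q.2), hH _ γ.continuous⟩, ?_, ?_⟩, ?_⟩⟩
    · intro t
      simp [hzero]
    · intro t
      simp [hone, α]
    · rintro s t (rfl | ht)
      · simp [hfix]
      · obtain rfl : t = 1 := ht
        simp [hfix]

theorem mem_sineGraph {p : ℝ × ℝ} :
    p ∈ sineGraph ↔ 0 < p.1 ∧ p.1 ≤ 1 ∧ p.2 = Real.sin (π / p.1) := by
  constructor
  · rintro ⟨x, hx, hx', rfl⟩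
    exact ⟨hx, hx', rfl⟩
  · rintro ⟨hx, hx', h⟩
    exact ⟨p.1, hx, hx', Prod.ext rfl h⟩

theorem mem_warsawArc_union_secondArc {p : ℝ × ℝ} : p ∈ warsawArc ∪ secondArc ↔
    (p.1 = 1 ∧ -2 ≤ p.2 ∧ p.2 ≤ 0) ∨ ((0 ≤ p.1 ∧ p.1 ≤ 1) ∧ p.2 = -2) ∨
    (p.1 = 0 ∧ -2 ≤ p.2 ∧ p.2 ≤ -1) ∨ ((1 ≤ p.1 ∧ p.1 ≤ 2) ∧ p.2 = 0) ∨
    (p.1 = 2 ∧ -3 ≤ p.2 ∧ p.2 ≤ 0) ∨ ((-1 ≤ p.1 ∧ p.1 ≤ 2) ∧ p.2 = -3) ∨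
    (p.1 = -1 ∧ -3 ≤ p.2 ∧ p.2 ≤ -1) ∨ ((-1 ≤ p.1 ∧ p.1 ≤ 0) ∧ p.2 = -1) := by
  simp only [warsawArc, secondArc, mem_union, mem_prod, mem_singleton_iff, mem_Icc, or_assoc]

theorem mem_Xtwo {p : ℝ × ℝ} : p ∈ Xtwo ↔
    p ∈ sineGraph ∨ p ∈ ({0} : Set ℝ) ×ˢ Icc (-1 : ℝ) 1 ∨ p ∈ warsawArc ∪ secondArc := by
  simp only [Xtwo, WarsawCircle, SineCurve, mem_union]
  tauto

theorem isClosed_warsawArc_union_secondArc : IsClosed (warsawArc ∪ secondArc) := by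
  have hs (a : ℝ) : IsClosed ({a} : Set ℝ) := isClosed_singleton
  have hi (a b : ℝ) : IsClosed (Icc a b) := isClosed_Icc
  exact ((((hs _).prod (hi _ _)).union ((hi _ _).prod (hs _))).union
    ((hs _).prod (hi _ _))).union ((((((hi _ _).prod (hs _)).union ((hs _).prod (hi _ _))).union
    ((hi _ _).prod (hs _))).union ((hs _).prod (hi _ _))).union ((hi _ _).prod (hs _)))

theorem mem_sineGraph_of_mem_Xtwo {p : ℝ × ℝ} (hp : p ∈ Xtwo) (h₀ : 0 < p.1) (h₁ : p.1 < 1 / 2)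
    (h₂ : -(3 / 2) < p.2) : p ∈ sineGraph := by
  rcases mem_Xtwo.1 hp with h | h | h
  · exact h
  · exact absurd h.1 h₀.ne'
  · rw [mem_warsawArc_union_secondArc] at h
    rcases h with h | h | h | h | h | h | h | h <;> linarith [h.1, h.2]

/-- Arbitrarily close to `0`, the function `x ↦ sin (π / x)` takes the values `1` and `-1`. -/
theorem exists_sin_pi_div_eq_one_and_neg_one {δ : ℝ} (hδ : 0 < δ) :
    (∃ x, 0 < x ∧ x ≤ δ ∧ Real.sin (π / x) = 1) ∧
      ∃ x, 0 < x ∧ x ≤ δ ∧ Real.sin (π / x) = -1 := by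
  obtain ⟨n, hn⟩ := exists_nat_gt (1 / δ)
  have hn' : 0 ≤ (n : ℝ) := n.cast_nonneg
  rw [div_lt_iff₀ hδ] at hn
  refine ⟨⟨1 / (2 * n + 1 / 2), by positivity, ?_, ?_⟩, ⟨1 / (2 * n + 3 / 2), by positivity, ?_, ?_⟩⟩
  · rw [div_le_iff₀ (by positivity)]
    nlinarith
  · rw [show π / (1 / (2 * n + 1 / 2)) = π / 2 + n * (2 * π) by field_simp; ring,
      Real.sin_add_nat_mul_two_pi, Real.sin_pi_div_two]
  · rw [div_le_iff₀ (by positivity)]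
    nlinarith
  · rw [show π / (1 / (2 * n + 3 / 2)) = π / 2 + π + n * (2 * π) by field_simp; ring,
      Real.sin_add_nat_mul_two_pi, Real.sin_add_pi, Real.sin_pi_div_two]

/-- A continuous map from a locally connected space to `X₂` cannot approach the limit segment
of the Sine Curve along its graph part. -/
theorem isClosed_preimage_sineGraph {Z : Type*} [TopologicalSpace Z] [LocallyConnectedSpace Z]
    {f : Z → ℝ × ℝ} (hf : Continuous f) (hmem : ∀ z, f z ∈ Xtwo) :
    IsClosed (f ⁻¹' sineGraph) := by
  refine isOpen_compl_iff.1 (isOpen_iff_mem_nhds.2 fun z hz ↦ ?_)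
  have hz : f z ∉ sineGraph := hz
  rcases lt_trichotomy (f z).1 0 with h | h | h
  · filter_upwards [hf.fst.continuousAt.eventually (gt_mem_nhds h)] with w hw hw'
    exact hw.not_gt (mem_sineGraph.1 hw').1
  · have hU : f ⁻¹' (Ioo (-1 / 2) (1 / 2) ×ˢ Ioo ((f z).2 - 1 / 4) ((f z).2 + 1 / 4)) ∈ 𝓝 z :=
      hf.continuousAt.preimage_mem_nhds
        ((isOpen_Ioo.prod isOpen_Ioo).mem_nhds (by norm_num [h]))
    filter_upwards [connectedComponentIn_mem_nhds hU] with w hw hw'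
    obtain ⟨hw₀, -, hw₂⟩ := mem_sineGraph.1 hw'
    have hle := Real.neg_one_le_sin (π / (f w).1)
    have hwU := (connectedComponentIn_subset _ _ hw).2
    have key : ∀ x, 0 < x → x ≤ (f w).1 → |Real.sin (π / x) - (f z).2| < 1 / 4 := by
      intro x hx hxw
      obtain ⟨v, hv, rfl⟩ := isPreconnected_connectedComponentIn.intermediate_value
        (mem_connectedComponentIn (mem_of_mem_nhds hU)) hw hf.fst.continuousOn
        ⟨h.le.trans hx.le, hxw⟩
      obtain ⟨hv₁, hv₂⟩ := connectedComponentIn_subset _ _ hv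
      have := (mem_sineGraph.1 (mem_sineGraph_of_mem_Xtwo (hmem v) hx hv₁.2
        (by linarith [hv₂.1, hwU.2]))).2.2
      rw [← this, abs_lt]
      constructor <;> linarith [hv₂.1, hv₂.2]
    obtain ⟨⟨x, hx, hxw, hx'⟩, ⟨y, hy, hyw, hy'⟩⟩ := exists_sin_pi_div_eq_one_and_neg_one hw₀
    have h₁ := abs_lt.1 (key x hx hxw)
    have h₂ := abs_lt.1 (key y hy hyw)
    rw [hx'] at h₁
    rw [hy'] at h₂
    linarith [h₁.2, h₂.1]
  · by_cases h' : (f z).1 ≤ 1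
    · have hne : (f z).2 ≠ Real.sin (π / (f z).1) := fun h'' ↦ hz (mem_sineGraph.2 ⟨h, h', h''⟩)
      have hc : ContinuousAt (fun w ↦ Real.sin (π / (f w).1)) z :=
        Real.continuous_sin.continuousAt.comp
          (continuousAt_const.div hf.fst.continuousAt h.ne')
      filter_upwards [(hf.snd.continuousAt.prodMk hc).eventually
        (isOpen_ne_fun continuous_fst continuous_snd |>.mem_nhds hne)] with w hw hw'
      exact hw (mem_sineGraph.1 hw').2.2
    · filter_upwards [hf.fst.continuousAt.eventually (lt_mem_nhds (not_le.1 h'))] with w hw hw'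
      exact hw.not_ge (mem_sineGraph.1 hw').2.1

open Classical in
/-- The homotopy pushing the graph part of the Sine Curve along itself to `(1, 0)` and the limit
segment down to `(0, -1)`, fixing everything else. -/
noncomputable def slide (s : ℝ) (p : ℝ × ℝ) : ℝ × ℝ :=
  if p ∈ sineGraph then (p.1 + s * (1 - p.1), Real.sin (π / (p.1 + s * (1 - p.1))))
  else if p ∈ ({0} : Set ℝ) ×ˢ Icc (-1 : ℝ) 1 then (0, p.2 - s * (p.2 + 1))
  else p

theorem slide_of_mem_sineGraph {s : ℝ} {p : ℝ × ℝ} (hp : p ∈ sineGraph) :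
    slide s p = (p.1 + s * (1 - p.1), Real.sin (π / (p.1 + s * (1 - p.1)))) :=
  if_pos hp

theorem slide_of_mem_segment {s : ℝ} {p : ℝ × ℝ} (hp : p ∈ ({0} : Set ℝ) ×ˢ Icc (-1 : ℝ) 1) :
    slide s p = (0, p.2 - s * (p.2 + 1)) := by
  have : p ∉ sineGraph := fun h ↦ (mem_sineGraph.1 h).1.ne' hp.1
  rw [slide, if_neg this, if_pos hp]

theorem slide_of_mem_arcs {s : ℝ} {p : ℝ × ℝ} (hp : p ∈ warsawArc ∪ secondArc) :
    slide s p = p := by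
  have hp' := mem_warsawArc_union_secondArc.1 hp
  by_cases h : p ∈ sineGraph
  · rw [slide_of_mem_sineGraph h]
    obtain ⟨h₀, h₁, h₂⟩ := mem_sineGraph.1 h
    have hle := Real.neg_one_le_sin (π / p.1)
    have hp₁ : p.1 = 1 := by
      rcases hp' with h | h | h | h | h | h | h | h <;> linarith [h.1, h.2]
    rw [hp₁] at h₂
    ext <;> simp [hp₁, h₂]
  · by_cases h' : p ∈ ({0} : Set ℝ) ×ˢ Icc (-1 : ℝ) 1
    · rw [slide_of_mem_segment h']
      have h₁ : p.1 = 0 := h'.1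
      obtain ⟨h₂, h₃⟩ := h'.2
      have hp₂ : p.2 = -1 := by
        rcases hp' with h | h | h | h | h | h | h | h <;> linarith [h.1, h.2]
      ext <;> simp [h₁, hp₂]
    · rw [slide, if_neg h, if_neg h']

theorem slide_zero {p : ℝ × ℝ} (hp : p ∈ Xtwo) : slide 0 p = p := by
  rcases mem_Xtwo.1 hp with h | h | h
  · rw [slide_of_mem_sineGraph h]
    ext <;> simp [(mem_sineGraph.1 h).2.2]
  · rw [slide_of_mem_segment h]
    ext <;> simp [show p.1 = 0 from h.1]
  · exact slide_of_mem_arcs h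

theorem slide_one_mem {p : ℝ × ℝ} (hp : p ∈ Xtwo) : slide 1 p ∈ warsawArc ∪ secondArc := by
  rcases mem_Xtwo.1 hp with h | h | h
  · rw [slide_of_mem_sineGraph h, mem_warsawArc_union_secondArc]
    simp
  · rw [slide_of_mem_segment h, mem_warsawArc_union_secondArc]
    norm_num
  · rwa [slide_of_mem_arcs h]

theorem slide_mem_Xtwo {s : ℝ} (hs : s ∈ Icc (0 : ℝ) 1) {p : ℝ × ℝ} (hp : p ∈ Xtwo) :
    slide s p ∈ Xtwo := by
  obtain ⟨hs₀, hs₁⟩ := hs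
  rcases mem_Xtwo.1 hp with h | h | h
  · rw [slide_of_mem_sineGraph h]
    obtain ⟨h₀, h₁, -⟩ := mem_sineGraph.1 h
    exact mem_Xtwo.2 (.inl (mem_sineGraph.2 ⟨by dsimp only; nlinarith, by dsimp only; nlinarith, rfl⟩))
  · rw [slide_of_mem_segment h]
    obtain ⟨h₀, h₁⟩ := h.2
    exact mem_Xtwo.2 (.inr (.inl ⟨rfl, by dsimp only; nlinarith, by dsimp only; nlinarith⟩))
  · rwa [slide_of_mem_arcs h]

theorem continuous_slide_comp {Z : Type*} [TopologicalSpace Z] [LocallyConnectedSpace Z]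
    {f : Z → ℝ × ℝ} (hf : Continuous f) (hmem : ∀ z, f z ∈ Xtwo) :
    Continuous fun q : I × Z ↦ slide q.1 (f q.2) := by
  have hf' : Continuous fun q : I × Z ↦ f q.2 := hf.comp continuous_snd
  have hs : Continuous fun q : I × Z ↦ (q.1 : ℝ) := by fun_prop
  have hgraph : ContinuousOn (fun q : I × Z ↦ slide q.1 (f q.2))
      (Prod.snd ⁻¹' (f ⁻¹' sineGraph)) := by
    have hx : Continuous fun q : I × Z ↦ (f q.2).1 + q.1 * (1 - (f q.2).1) :=
      hf'.fst.add (hs.mul (continuous_const.sub hf'.fst))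
    have : ContinuousOn (fun q : I × Z ↦ ((f q.2).1 + q.1 * (1 - (f q.2).1),
        Real.sin (π / ((f q.2).1 + q.1 * (1 - (f q.2).1))))) (Prod.snd ⁻¹' (f ⁻¹' sineGraph)) := by
      refine hx.continuousOn.prodMk (Real.continuous_sin.comp_continuousOn
        (continuousOn_const.div hx.continuousOn ?_))
      rintro ⟨⟨s, hs₀, hs₁⟩, z⟩ hz
      obtain ⟨h₀, h₁, -⟩ := mem_sineGraph.1 hz
      dsimp only at h₀ h₁ ⊢
      nlinarith
    exact this.congr fun q hq ↦ slide_of_mem_sineGraph hq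
  have hsegment : ContinuousOn (fun q : I × Z ↦ slide q.1 (f q.2))
      (Prod.snd ⁻¹' (f ⁻¹' (({0} : Set ℝ) ×ˢ Icc (-1 : ℝ) 1))) := by
    have : Continuous fun q : I × Z ↦ ((0 : ℝ), (f q.2).2 - q.1 * ((f q.2).2 + 1)) :=
      continuous_const.prodMk (hf'.snd.sub (hs.mul (hf'.snd.add continuous_const)))
    exact this.continuousOn.congr fun q hq ↦ slide_of_mem_segment hq
  have harcs : ContinuousOn (fun q : I × Z ↦ slide q.1 (f q.2))
      (Prod.snd ⁻¹' (f ⁻¹' (warsawArc ∪ secondArc))) :=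
    hf'.continuousOn.congr fun q hq ↦ slide_of_mem_arcs hq
  have hclosed₁ := (isClosed_preimage_sineGraph hf hmem).preimage (continuous_snd (X := I))
  have hclosed₂ := ((isClosed_singleton.prod isClosed_Icc :
    IsClosed (({0} : Set ℝ) ×ˢ Icc (-1 : ℝ) 1)).preimage hf).preimage (continuous_snd (X := I))
  have hclosed₃ := (isClosed_warsawArc_union_secondArc.preimage hf).preimage
    (continuous_snd (X := I))
  rw [← continuousOn_univ]
  refine (hgraph.union_of_isClosed (hsegment.union_of_isClosed harcs hclosed₂ hclosed₃) hclosed₁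
    (hclosed₂.union hclosed₃)).mono fun q _ ↦ mem_Xtwo.1 (hmem q.2)

/-- The function of slope `1` on `[a, b]`, constant elsewhere, that vanishes at `a`. -/
noncomputable def ramp (a b t : ℝ) : ℝ := max a (min b t) - a

theorem continuous_ramp (a b : ℝ) : Continuous (ramp a b) := by
  unfold ramp
  fun_prop

theorem ramp_of_le_left {a b t : ℝ} (hab : a ≤ b) (h : t ≤ a) : ramp a b t = 0 := by
  grind [ramp]

theorem ramp_of_le_of_le {a b t : ℝ} (h₁ : a ≤ t) (h₂ : t ≤ b) : ramp a b t = t - a := by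
  grind [ramp]

theorem ramp_of_right_le {a b t : ℝ} (hab : a ≤ b) (h : b ≤ t) : ramp a b t = b - a := by
  grind [ramp]

/-- The unit-speed closed curve running through `A` from `(1, 0)` to `(0, -1)` and back
through `B`. -/
noncomputable def arcsCurve (t : ℝ) : ℝ × ℝ :=
  (1 - ramp 2 3 t - ramp 4 5 t + ramp 7 10 t - ramp 13 14 t,
    ramp 3 4 t - ramp 0 2 t - ramp 5 7 t + ramp 10 13 t)

theorem continuous_arcsCurve : Continuous arcsCurve := by
  have := continuous_ramp
  unfold arcsCurve
  fun_prop

theorem arcsCurve_cases {t : ℝ} (ht : t ∈ Icc (0 : ℝ) 14) :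
    (0 ≤ t ∧ t ≤ 2 ∧ (arcsCurve t).1 = 1 ∧ (arcsCurve t).2 = -t) ∨
    (2 ≤ t ∧ t ≤ 3 ∧ (arcsCurve t).1 = 3 - t ∧ (arcsCurve t).2 = -2) ∨
    (3 ≤ t ∧ t ≤ 4 ∧ (arcsCurve t).1 = 0 ∧ (arcsCurve t).2 = t - 5) ∨
    (4 ≤ t ∧ t ≤ 5 ∧ (arcsCurve t).1 = 4 - t ∧ (arcsCurve t).2 = -1) ∨
    (5 ≤ t ∧ t ≤ 7 ∧ (arcsCurve t).1 = -1 ∧ (arcsCurve t).2 = 4 - t) ∨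
    (7 ≤ t ∧ t ≤ 10 ∧ (arcsCurve t).1 = t - 8 ∧ (arcsCurve t).2 = -3) ∨
    (10 ≤ t ∧ t ≤ 13 ∧ (arcsCurve t).1 = 2 ∧ (arcsCurve t).2 = t - 13) ∨
    (13 ≤ t ∧ t ≤ 14 ∧ (arcsCurve t).1 = 15 - t ∧ (arcsCurve t).2 = 0) := by
  obtain ⟨h₀, h₁⟩ := ht
  have hcases : (0 ≤ t ∧ t ≤ 2) ∨ (2 ≤ t ∧ t ≤ 3) ∨ (3 ≤ t ∧ t ≤ 4) ∨ (4 ≤ t ∧ t ≤ 5) ∨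
      (5 ≤ t ∧ t ≤ 7) ∨ (7 ≤ t ∧ t ≤ 10) ∨ (10 ≤ t ∧ t ≤ 13) ∨ (13 ≤ t ∧ t ≤ 14) := by
    grind
  refine hcases.imp ?_ <| Or.imp ?_ <| Or.imp ?_ <| Or.imp ?_ <| Or.imp ?_ <| Or.imp ?_ <|
    Or.imp ?_ ?_
  all_goals
    rintro ⟨h, h'⟩
    refine ⟨h, h', ?_, ?_⟩ <;> dsimp only [arcsCurve] <;>
    grind [ramp_of_le_left, ramp_of_le_of_le, ramp_of_right_le]

theorem arcsCurve_mem {t : ℝ} (ht : t ∈ Icc (0 : ℝ) 14) :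
    arcsCurve t ∈ warsawArc ∪ secondArc := by
  rw [mem_warsawArc_union_secondArc]
  rcases arcsCurve_cases ht with h | h | h | h | h | h | h | h <;> grind

theorem injOn_arcsCurve : InjOn arcsCurve (Ico 0 14) := by
  intro s hs t ht h
  have h₁ := congrArg Prod.fst h
  have h₂ := congrArg Prod.snd h
  have hs' := hs.2
  have ht' := ht.2
  rcases arcsCurve_cases (Ico_subset_Icc_self hs) with a | a | a | a | a | a | a | a <;>
  rcases arcsCurve_cases (Ico_subset_Icc_self ht) with b | b | b | b | b | b | b | b <;>
  (obtain ⟨a₁, a₂, a₃, a₄⟩ := a; obtain ⟨b₁, b₂, b₃, b₄⟩ := b; linarith)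

theorem exists_arcsCurve_eq {p : ℝ × ℝ} (hp : p ∈ warsawArc ∪ secondArc) :
    ∃ t ∈ Ico (0 : ℝ) 14, arcsCurve t = p := by
  obtain ⟨x, y⟩ := p
  have key (t : ℝ) (h₀ : 0 ≤ t) (h₁ : t < 14)
      (h : (arcsCurve t).1 = x ∧ (arcsCurve t).2 = y) :
      ∃ t ∈ Ico (0 : ℝ) 14, arcsCurve t = (x, y) := ⟨t, ⟨h₀, h₁⟩, Prod.ext h.1 h.2⟩
  rw [mem_warsawArc_union_secondArc] at hp
  dsimp only at hp
  rcases hp with ⟨h, h', h''⟩ | ⟨⟨h, h'⟩, h''⟩ | ⟨h, h', h''⟩ | ⟨⟨h, h'⟩, h''⟩ | ⟨h, h', h''⟩ |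
    ⟨⟨h, h'⟩, h''⟩ | ⟨h, h', h''⟩ | ⟨⟨h, h'⟩, h''⟩
  · exact key (-y) (by linarith) (by linarith) (by grind [arcsCurve_cases (t := -y) ⟨by linarith, by linarith⟩])
  · exact key (3 - x) (by linarith) (by linarith) (by grind [arcsCurve_cases (t := 3 - x) ⟨by linarith, by linarith⟩])
  · exact key (y + 5) (by linarith) (by linarith) (by grind [arcsCurve_cases (t := y + 5) ⟨by linarith, by linarith⟩])
  · obtain rfl | h := h.eq_or_lt
    · exact key 0 (by linarith) (by linarith) (by grind [arcsCurve_cases (t := 0) ⟨by linarith, by linarith⟩])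
    · exact key (15 - x) (by linarith) (by linarith) (by grind [arcsCurve_cases (t := 15 - x) ⟨by linarith, by linarith⟩])
  · exact key (y + 13) (by linarith) (by linarith) (by grind [arcsCurve_cases (t := y + 13) ⟨by linarith, by linarith⟩])
  · exact key (x + 8) (by linarith) (by linarith) (by grind [arcsCurve_cases (t := x + 8) ⟨by linarith, by linarith⟩])
  · exact key (4 - y) (by linarith) (by linarith) (by grind [arcsCurve_cases (t := 4 - y) ⟨by linarith, by linarith⟩])
  · exact key (4 - x) (by linarith) (by linarith) (by grind [arcsCurve_cases (t := 4 - x) ⟨by linarith, by linarith⟩])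

/-- The inclusion of the simple closed curve `A ∪ B` into `X₂`, parametrized by a circle. -/
theorem exists_addCircle_map_Xtwo : ∃ e : C(AddCircle (14 : ℝ), Xtwo),
    Function.Injective e ∧ range (fun c ↦ (e c : ℝ × ℝ)) = warsawArc ∪ secondArc := by
  have : Fact ((0 : ℝ) < 14) := ⟨by norm_num⟩
  have hIco (t : ℝ) : t ∈ Ico (0 : ℝ) (0 + 14) ↔ t ∈ Ico (0 : ℝ) 14 := by rw [zero_add]
  let g : AddCircle (14 : ℝ) → ℝ × ℝ := AddCircle.liftIco 14 0 arcsCurve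
  have hg (t : ℝ) (ht : t ∈ Ico (0 : ℝ) 14) : g t = arcsCurve t :=
    AddCircle.liftIco_zero_coe_apply ht
  have hsurj (c : AddCircle (14 : ℝ)) : ∃ t ∈ Ico (0 : ℝ) 14, (t : AddCircle (14 : ℝ)) = c :=
    ⟨AddCircle.equivIco 14 0 c, (hIco _).1 (AddCircle.equivIco 14 0 c).2, AddCircle.coe_equivIco⟩
  have hcont : Continuous g := by
    refine AddCircle.liftIco_continuous ?_ continuous_arcsCurve.continuousOn
    simp only [arcsCurve, ramp]
    norm_num
  have hmem (c) : g c ∈ warsawArc ∪ secondArc := by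
    obtain ⟨t, ht, rfl⟩ := hsurj c
    rw [hg t ht]
    exact arcsCurve_mem (Ico_subset_Icc_self ht)
  refine ⟨⟨fun c ↦ ⟨g c, mem_Xtwo.2 (.inr (.inr (hmem c)))⟩, hcont.subtype_mk _⟩, ?_, ?_⟩
  · intro c d hcd
    obtain ⟨s, hs, rfl⟩ := hsurj c
    obtain ⟨t, ht, rfl⟩ := hsurj d
    have : g s = g t := congrArg Subtype.val hcd
    rw [hg s hs, hg t ht] at this
    rw [injOn_arcsCurve hs ht this]
  · refine Subset.antisymm (range_subset_iff.2 hmem) fun p hp ↦ ?_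
    obtain ⟨t, ht, rfl⟩ := exists_arcsCurve_eq hp
    exact ⟨t, hg t ht⟩

/-- The fundamental group of `X₂ = W ∪ B` is isomorphic to `ℤ`. -/
theorem fundamentalGroup_Xtwo_isomorphic_int :
    ∃ x₀ : Xtwo, Nonempty (FundamentalGroup Xtwo x₀ ≃* Multiplicative ℤ) := by
  have : Fact ((0 : ℝ) < 14) := ⟨by norm_num⟩
  obtain ⟨e, hinj, hrange⟩ := exists_addCircle_map_Xtwo
  have hmem (c) : (e c : ℝ × ℝ) ∈ warsawArc ∪ secondArc := hrange ▸ mem_range_self c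
  have hproj (s : ℝ) : (projIcc 0 1 zero_le_one s : ℝ) ∈ Icc (0 : ℝ) 1 := Subtype.prop _
  let H (s : ℝ) (x : Xtwo) : Xtwo :=
    ⟨slide (projIcc 0 1 zero_le_one s) x, slide_mem_Xtwo (hproj s) x.2⟩
  have hH {Z : Type} [TopologicalSpace Z] [LocallyConnectedSpace Z] (f : Z → Xtwo)
      (hf : Continuous f) : Continuous fun q : I × Z ↦ H q.1 (f q.2) := by
    refine Continuous.subtype_mk ?_ _
    simpa using continuous_slide_comp (continuous_subtype_val.comp hf) fun z ↦ (f z).2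
  have hretract (x : Xtwo) : ∃ c, e c = H 1 x := by
    obtain ⟨c, hc⟩ : slide 1 x ∈ range fun c ↦ (e c : ℝ × ℝ) := hrange ▸ slide_one_mem x.2
    exact ⟨c, Subtype.ext (by simpa [H] using hc)⟩
  choose ρ hρ using hretract
  have hfix (s : ℝ) (c) : H s (e c) = e c := Subtype.ext (slide_of_mem_arcs (hmem c))
  have hbij := bijective_fundamentalGroup_map_of_slide e ρ H 0
    (fun f hf ↦ (e.continuous.isClosedEmbedding hinj).isEmbedding.continuous_iff.2 <| by
      have := (hH f hf).comp (Continuous.prodMk_right (1 : I))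
      simpa [Function.comp_def, hρ] using this)
    hH (fun c ↦ hinj ((hρ _).trans (hfix 1 c)))
    (fun x ↦ Subtype.ext (by simpa [H] using slide_zero x.2)) (fun x ↦ (hρ x).symm)
    (fun s ↦ hfix s 0)
  obtain ⟨φ⟩ := nonempty_fundamentalGroup_addCircle_mulEquiv (p := 14) (by norm_num)
  exact ⟨e 0, ⟨(MulEquiv.ofBijective _ hbij).symm.trans φ⟩⟩
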